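/- arXiv:2511.13698 — 2 statements merged into one kernel-verified Lean document; each statement's English description precedes it below -/
import Mathlib

section
/- Let C > 0 and c > 0 be real constants, let f : ℝ → ℝ be continuous, fix t > 0, and define the bang-bang signal a(τ) := −C for τ < t and a(τ) := C for τ ≥ t. Then the output y_a(t) := c·a(t) − ∫_0^t f(t−τ)·a(τ) dτ satisfies y_a(t) = c·C + C·∫_0^t f(s) ds, and |a(τ)| ≤ C for all τ. In particular, when f(s) > 0 for all s ≥ 0, this signal attains the maximal possible output magnitude c·C + C·∫_0^t f(s) ds at time t among all measurable signals bounded by C. -/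
open MeasureTheory intervalIntegral

/-- The output at time `t` of the signal that equals `-C` before `t` and `C` from `t` on. -/
lemma bang_bang_output (C c : ℝ) (f : ℝ → ℝ) {t : ℝ} (ht : 0 ≤ t) :
    (c * (if t < t then -C else C) -
      ∫ τ in (0:ℝ)..t, f (t - τ) * (if τ < t then -C else C)) =
      c * C + C * ∫ s in (0:ℝ)..t, f s := by
  have h : ∫ τ in (0:ℝ)..t, f (t - τ) * (if τ < t then -C else C) =
      ∫ τ in (0:ℝ)..t, f (t - τ) * -C := by
    refine integral_congr_ae ?_
    filter_upwards [Measure.ae_ne volume t] with τ hne hτ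
    rw [Set.uIoc_of_le ht] at hτ
    rw [if_pos (lt_of_le_of_ne hτ.2 hne)]
  rw [h, intervalIntegral.integral_mul_const, integral_comp_sub_left f t, sub_self, sub_zero,
    if_neg (lt_irrefl t)]
  ring

/-- A signal bounded by `C` produces an output of magnitude at most `c C + C ∫₀ᵗ f` when the
kernel `f` is nonnegative. -/
lemma abs_output_le {C c : ℝ} (hc : 0 ≤ c) {f : ℝ → ℝ} (hf : Continuous f)
    (hpos : ∀ s ≥ (0:ℝ), 0 ≤ f s) {t : ℝ} (ht : 0 ≤ t) {b : ℝ → ℝ} (hb : ∀ τ, |b τ| ≤ C) :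
    |c * b t - ∫ τ in (0:ℝ)..t, f (t - τ) * b τ| ≤ c * C + C * ∫ s in (0:ℝ)..t, f s := by
  have hcont : Continuous fun τ => f (t - τ) * C := by fun_prop
  have hint : |∫ τ in (0:ℝ)..t, f (t - τ) * b τ| ≤ ∫ τ in (0:ℝ)..t, f (t - τ) * C := by
    rw [← Real.norm_eq_abs]
    refine norm_integral_le_of_norm_le ht (.of_forall fun τ hτ => ?_)
      (hcont.intervalIntegrable 0 t)
    have hfτ := hpos (t - τ) (sub_nonneg.2 hτ.2)
    rw [Real.norm_eq_abs, abs_mul, abs_of_nonneg hfτ]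
    exact mul_le_mul_of_nonneg_left (hb τ) hfτ
  rw [intervalIntegral.integral_mul_const, integral_comp_sub_left f t, sub_self, sub_zero,
    mul_comm] at hint
  have hdirect : |c * b t| ≤ c * C := by
    rw [abs_mul, abs_of_nonneg hc]
    exact mul_le_mul_of_nonneg_left (hb t) hc
  exact (abs_sub _ _).trans (add_le_add hdirect hint)

/-- Achievability (Lemma 4): the bang-bang signal `a(τ) = −C` for `τ < t`, `a(τ) = C`
for `τ ≥ t`, is admissible and its output attains `c·C + C·∫₀ᵗ f(s) ds` at time `t`;
when `f > 0` on `[0, ∞)`, this is maximal among all measurable signals bounded by `C`. -/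
theorem bang_bang_attains_max (C c : ℝ) (hC : 0 < C) (hc : 0 < c)
    (f : ℝ → ℝ) (hf : Continuous f) (t : ℝ) (ht : 0 < t)
    (a : ℝ → ℝ) (ha : a = fun τ => if τ < t then -C else C) :
    (c * a t - ∫ τ in (0:ℝ)..t, f (t - τ) * a τ) =
      c * C + C * ∫ s in (0:ℝ)..t, f s ∧
    (∀ τ : ℝ, |a τ| ≤ C) ∧
    ((∀ s ≥ (0:ℝ), 0 < f s) → ∀ b : ℝ → ℝ, Measurable b → (∀ τ : ℝ, |b τ| ≤ C) →
      |c * b t - ∫ τ in (0:ℝ)..t, f (t - τ) * b τ| ≤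
        c * a t - ∫ τ in (0:ℝ)..t, f (t - τ) * a τ) := by
  subst ha
  have hout := bang_bang_output C c f ht.le
  refine ⟨hout, fun τ => ?_, fun hpos b _ hb => ?_⟩
  · dsimp only
    split_ifs <;> simp [abs_of_pos hC]
  · exact (abs_output_le hc.le hf (fun s hs => (hpos s hs).le) ht.le hb).trans_eq hout.symm
end

section
/- Let C > 0 and c > 0 be real constants and let f : ℝ → ℝ be continuous with f(s) > 0 for all s ≥ 0, integrable on [0,∞), and satisfying ∫_0^∞ f(s) ds = c. For a measurable a : ℝ → ℝ with |a(τ)| ≤ C for all τ ≥ 0, define y_a(t) := c·a(t) − ∫_0^t f(t−τ)·a(τ) dτ for t ≥ 0. Then sup over all such admissible signals a of sup_{t ≥ 0} |y_a(t)| equals exactly 2·c·C (the supremum is approached but the value 2cC is the least upper bound). -/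
open MeasureTheory intervalIntegral

/-- Theorem 1 (scalar convolution form): the supremum, over all measurable signals `a`
bounded by `C` on `[0, ∞)` and all times `t ≥ 0`, of `|y_a(t)|` with
`y_a(t) = c·a(t) − ∫₀ᵗ f(t−τ)·a(τ) dτ` equals exactly `2·c·C`. -/
theorem worst_case_output_isLUB (C c : ℝ) (hC : 0 < C) (hc : 0 < c)
    (f : ℝ → ℝ) (hf : Continuous f) (hfpos : ∀ s ≥ (0:ℝ), 0 < f s)
    (hfi : IntegrableOn f (Set.Ici 0))
    (hfint : ∫ s in Set.Ioi (0:ℝ), f s = c) :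
    IsLUB {r : ℝ | ∃ a : ℝ → ℝ, Measurable a ∧ (∀ τ ≥ (0:ℝ), |a τ| ≤ C) ∧
        ∃ t ≥ (0:ℝ), r = |c * a t - ∫ τ in (0:ℝ)..t, f (t - τ) * a τ|}
      (2 * c * C) := by
  have hfi' : IntegrableOn f (Set.Ioi 0) := hfi.mono_set Set.Ioi_subset_Ici_self
  have hsub (t : ℝ) : ∫ τ in (0:ℝ)..t, f (t - τ) = ∫ s in (0:ℝ)..t, f s := by
    rw [intervalIntegral.integral_comp_sub_left f t]
    simp
  constructor
  · rintro r ⟨a, -, ha, t, ht, rfl⟩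
    have hle : ∫ s in (0:ℝ)..t, f s ≤ c := by
      rw [intervalIntegral.integral_of_le ht, ← hfint]
      refine setIntegral_mono_set hfi' ?_ Set.Ioc_subset_Ioi_self.eventuallyLE
      exact (ae_restrict_mem measurableSet_Ioi).mono fun s hs => (hfpos s (le_of_lt hs)).le
    have hconv : |∫ τ in (0:ℝ)..t, f (t - τ) * a τ| ≤ c * C := by
      have hbound : ‖∫ τ in (0:ℝ)..t, f (t - τ) * a τ‖ ≤ ∫ τ in (0:ℝ)..t, f (t - τ) * C := by
        refine intervalIntegral.norm_integral_le_of_norm_le ht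
          (Filter.Eventually.of_forall fun τ hτ => ?_)
          (Continuous.intervalIntegrable (by fun_prop) _ _)
        have hpos := hfpos (t - τ) (sub_nonneg.2 hτ.2)
        rw [Real.norm_eq_abs, abs_mul, abs_of_pos hpos]
        exact mul_le_mul_of_nonneg_left (ha τ hτ.1.le) hpos.le
      rw [intervalIntegral.integral_mul_const, hsub] at hbound
      exact hbound.trans (mul_le_mul_of_nonneg_right hle hC.le)
    have hdirect : |c * a t| ≤ c * C := by
      rw [abs_mul, abs_of_pos hc]
      exact mul_le_mul_of_nonneg_left (ha t ht) hc.le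
    linarith [abs_sub (c * a t) (∫ τ in (0:ℝ)..t, f (t - τ) * a τ)]
  · intro b hb
    have hlim : Filter.Tendsto (fun t : ℝ => c * C + (∫ s in (0:ℝ)..t, f s) * C)
        Filter.atTop (nhds (c * C + c * C)) := by
      have h := intervalIntegral_tendsto_integral_Ioi 0 hfi' Filter.tendsto_id
      rw [hfint] at h
      exact (h.mul_const C).const_add (c * C)
    have hle : c * C + c * C ≤ b := by
      refine le_of_tendsto hlim ((Filter.eventually_ge_atTop 0).mono fun t ht => ?_)
      -- the extremal signal switches sign exactly at the observation time
      let a : ℝ → ℝ := fun τ => if τ = t then C else -C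
      refine (le_abs_self _).trans (hb ⟨a,
        Measurable.ite (measurableSet_singleton t) measurable_const measurable_const, ?_, t, ht, ?_⟩)
      · intro τ _
        by_cases h : τ = t <;> simp [a, h, abs_of_pos hC]
      · have hint : ∫ τ in (0:ℝ)..t, f (t - τ) * a τ = ∫ τ in (0:ℝ)..t, f (t - τ) * -C := by
          refine intervalIntegral.integral_congr_ae ?_
          filter_upwards [Measure.ae_ne volume t] with τ hτ _
          simp [a, hτ]
        rw [hint, intervalIntegral.integral_mul_const, hsub]
        simp [a]
    linarith
end
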